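/- arXiv:1201.4601 — 4 statements merged into one kernel-verified Lean document; each statement's English description precedes it below -/
import Mathlib

section
/- Let H be a real Hilbert space, let E : H → ℝ be differentiable with gradient ∇E, let T > 0, and let x : ℝ → H be differentiable with continuous derivative x' on [0,T], and suppose t ↦ ∇E(x(t)) is continuous on [0,T]. Then E(x(T)) − E(x(0)) + (1/2)∫₀ᵀ (‖x'(t)‖² + ‖∇E(x(t))‖²) dt = 0 if and only if x'(t) = −∇E(x(t)) for every t ∈ [0,T], i.e. if and only if x is a gradient flow of E on [0,T]. -/
open MeasureTheory intervalIntegral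

/-- Chain rule for a function with a gradient along a differentiable curve. -/
theorem HasGradientAt.comp_hasDerivAt_real
    {H : Type*} [NormedAddCommGroup H] [InnerProductSpace ℝ H] [CompleteSpace H]
    {E : H → ℝ} {g v : H} {x : ℝ → H} {t : ℝ}
    (hE : HasGradientAt E g (x t)) (hx : HasDerivAt x v t) :
    HasDerivAt (fun s => E (x s)) (inner ℝ g v) t := by
  have h := hE.hasFDerivAt.comp_hasDerivAt t hx
  rwa [InnerProductSpace.toDual_apply_apply] at h

/-- The integral of a continuous nonnegative function over `[a, b]` vanishes if and only if
the function does. -/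
theorem ContinuousOn.intervalIntegral_eq_zero_iff_of_nonneg
    {f : ℝ → ℝ} {a b : ℝ} (hab : a < b) (hf : ContinuousOn f (Set.Icc a b))
    (h0 : ∀ t ∈ Set.Icc a b, 0 ≤ f t) :
    ∫ t in a..b, f t = 0 ↔ ∀ t ∈ Set.Icc a b, f t = 0 := by
  constructor
  · intro h t ht
    by_contra hne
    have := intervalIntegral.integral_pos hab hf
      (fun s hs => h0 s (Set.Ioc_subset_Icc_self hs)) ⟨t, ht, lt_of_le_of_ne (h0 t ht) (Ne.symm hne)⟩
    exact this.ne' h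
  · intro h
    rw [intervalIntegral.integral_congr (g := fun _ => 0)
      (fun t ht => h t (by rwa [Set.uIcc_of_le hab.le] at ht))]
    simp

/-- Completing the square in the energy-dissipation functional. -/
theorem energy_dissipation_eq_half_integral_norm_sq
    {H : Type*} [NormedAddCommGroup H] [InnerProductSpace ℝ H] [CompleteSpace H]
    {E : H → ℝ} {E' : H → H} {x x' : ℝ → H} {a b : ℝ} (hab : a ≤ b)
    (hE : ∀ t ∈ Set.Icc a b, HasGradientAt E (E' (x t)) (x t))
    (hx : ∀ t ∈ Set.Icc a b, HasDerivAt x (x' t) t)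
    (hx' : ContinuousOn x' (Set.Icc a b))
    (hE'x : ContinuousOn (fun t => E' (x t)) (Set.Icc a b)) :
    E (x b) - E (x a) + (1/2) * ∫ t in a..b, (‖x' t‖^2 + ‖E' (x t)‖^2)
      = (1/2) * ∫ t in a..b, ‖x' t + E' (x t)‖^2 := by
  have hinner : IntervalIntegrable (fun t => inner ℝ (E' (x t)) (x' t)) volume a b :=
    (ContinuousOn.inner (𝕜 := ℝ) hE'x hx').intervalIntegrable_of_Icc hab
  have hsq : IntervalIntegrable (fun t => ‖x' t‖^2 + ‖E' (x t)‖^2) volume a b :=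
    ((hx'.norm.pow 2).add (hE'x.norm.pow 2)).intervalIntegrable_of_Icc hab
  have hftc : ∫ t in a..b, inner ℝ (E' (x t)) (x' t) = E (x b) - E (x a) :=
    integral_eq_sub_of_hasDerivAt (f := fun t => E (x t))
      (fun t ht => by
        rw [Set.uIcc_of_le hab] at ht
        exact (hE t ht).comp_hasDerivAt_real (hx t ht)) hinner
  have hexpand : ∀ t, ‖x' t + E' (x t)‖^2
      = (‖x' t‖^2 + ‖E' (x t)‖^2) + 2 * inner ℝ (E' (x t)) (x' t) := fun t => by
    rw [norm_add_sq_real, real_inner_comm]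
    ring
  simp_rw [hexpand]
  rw [intervalIntegral.integral_add hsq (hinner.const_mul 2),
    intervalIntegral.integral_const_mul, hftc]
  ring

theorem stmt_2
    {H : Type*} [NormedAddCommGroup H] [InnerProductSpace ℝ H] [CompleteSpace H]
    (E : H → ℝ) (E' : H → H) (hE : ∀ y, HasGradientAt E (E' y) y)
    (T : ℝ) (hT : 0 < T)
    (x x' : ℝ → H) (hx : ∀ t ∈ Set.Icc (0 : ℝ) T, HasDerivAt x (x' t) t)
    (hx' : ContinuousOn x' (Set.Icc (0 : ℝ) T))
    (hE'x : ContinuousOn (fun t => E' (x t)) (Set.Icc (0 : ℝ) T)) :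
    (E (x T) - E (x 0)
      + (1/2) * ∫ t in (0:ℝ)..T, (‖x' t‖^2 + ‖E' (x t)‖^2) = 0)
    ↔ ∀ t ∈ Set.Icc (0 : ℝ) T, x' t = -E' (x t) := by
  have hcont : ContinuousOn (fun t => ‖x' t + E' (x t)‖^2) (Set.Icc 0 T) :=
    (hx'.add hE'x).norm.pow 2
  rw [energy_dissipation_eq_half_integral_norm_sq hT.le (fun t _ => hE (x t)) hx hx' hE'x,
    mul_eq_zero_iff_left (by norm_num),
    hcont.intervalIntegral_eq_zero_iff_of_nonneg hT (fun t _ => by positivity)]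
  simp [add_eq_zero_iff_eq_neg]
end

section
/- For every m ∈ (−1,1) and every q ∈ ℝ, with a := (1/4)·log((1+m)/(1−m)), the following identity holds: (q/2)·log((q + √(q² + 4(1−m²)))/(2(1−m))) − (1/2)·√(q² + 4(1−m²)) + 1 = [(q/2)·log((q + √(q² + 4(1−m²)))/(2√(1−m²))) − (1/2)·√(q² + 4(1−m²))] + (1/2)·√(1−m²)·(e^{2a} + e^{−2a}) + q·a. In other words, the spin-flip Lagrangian decomposes as L(m,q) = ψ*(q) + ψ(−E'(m)) + q·E'(m), where E'(m) = (1/4)·log((1+m)/(1−m)). -/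
theorem stmt_8
    (m : ℝ) (hm : m ∈ Set.Ioo (-1 : ℝ) 1) (q : ℝ)
    (a : ℝ) (ha : a = (1/4) * Real.log ((1 + m) / (1 - m))) :
    (q/2) * Real.log ((q + Real.sqrt (q^2 + 4*(1 - m^2))) / (2*(1 - m)))
      - (1/2) * Real.sqrt (q^2 + 4*(1 - m^2)) + 1
    = ((q/2) * Real.log ((q + Real.sqrt (q^2 + 4*(1 - m^2))) / (2 * Real.sqrt (1 - m^2)))
        - (1/2) * Real.sqrt (q^2 + 4*(1 - m^2)))
      + (1/2) * Real.sqrt (1 - m^2) * (Real.exp (2*a) + Real.exp (-(2*a)))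
      + q * a := by
  obtain ⟨hm₁, hm₂⟩ := hm
  have hp : 0 < 1 + m := by linarith
  have hn : 0 < 1 - m := by linarith
  have hpn : 0 < 1 - m ^ 2 := by nlinarith
  have hfac : 1 - m ^ 2 = (1 + m) * (1 - m) := by ring
  have hN : 0 < q + Real.sqrt (q ^ 2 + 4 * (1 - m ^ 2)) := by
    have h : |q| < Real.sqrt (q ^ 2 + 4 * (1 - m ^ 2)) := by
      rw [← Real.sqrt_sq_eq_abs]
      exact Real.sqrt_lt_sqrt (sq_nonneg q) (by linarith)
    linarith [neg_abs_le q]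
  have hs : 0 < Real.sqrt (1 - m ^ 2) := Real.sqrt_pos.mpr hpn
  have hlogdiv : Real.log ((1 + m) / (1 - m)) = Real.log (1 + m) - Real.log (1 - m) :=
    Real.log_div hp.ne' hn.ne'
  have hlogsqrt : Real.log (Real.sqrt (1 - m ^ 2))
      = (Real.log (1 + m) + Real.log (1 - m)) / 2 := by
    rw [Real.log_sqrt hpn.le, hfac, Real.log_mul hp.ne' hn.ne']
  have hexp_pos : Real.sqrt (1 - m ^ 2) * Real.exp (2 * a) = 1 + m := by
    rw [← Real.exp_log hs, ← Real.exp_add, hlogsqrt, ha, hlogdiv]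
    convert Real.exp_log hp using 2
    ring
  have hexp_neg : Real.sqrt (1 - m ^ 2) * Real.exp (-(2 * a)) = 1 - m := by
    rw [← Real.exp_log hs, ← Real.exp_add, hlogsqrt, ha, hlogdiv]
    convert Real.exp_log hn using 2
    ring
  rw [Real.log_div hN.ne' (by positivity), Real.log_div hN.ne' (by positivity),
    Real.log_mul two_ne_zero hn.ne', Real.log_mul two_ne_zero hs.ne', hlogsqrt]
  have hqa : q * a = q / 4 * (Real.log (1 + m) - Real.log (1 - m)) := by
    rw [ha, hlogdiv]
    ring
  linear_combination -hqa - hexp_pos / 2 - hexp_neg / 2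
end

section
/- For every m ∈ (−1,1), with a := (1/4)·log((1+m)/(1−m)), one has √(1−m²)·(e^{−2a} − e^{2a}) = −2m. Consequently, a differentiable curve m : ℝ → (−1,1) satisfies the generalised gradient-flow equation m'(t) = ψ'(−E'(m(t))) (where ψ'(ξ) = √(1−m(t)²)·(e^{2ξ} − e^{−2ξ}) and E'(m) = (1/4)·log((1+m)/(1−m))) if and only if it satisfies the linear equation m'(t) = −2·m(t). -/
theorem sqrt_mul_exp_sub_exp_quarter_log {m : ℝ} (hm : m ∈ Set.Ioo (-1 : ℝ) 1) :
    Real.sqrt (1 - m^2) *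
      (Real.exp (-(2 * ((1/4) * Real.log ((1 + m) / (1 - m)))))
       - Real.exp (2 * ((1/4) * Real.log ((1 + m) / (1 - m))))) = -2 * m := by
  have hp : 0 < 1 + m := by linarith [hm.1]
  have hq : 0 < 1 - m := by linarith [hm.2]
  have hexp : Real.exp (2 * ((1/4) * Real.log ((1 + m) / (1 - m))))
      = Real.sqrt (1 + m) / Real.sqrt (1 - m) := by
    rw [← Real.sqrt_div hp.le, ← Real.exp_log (Real.sqrt_pos.2 (div_pos hp hq)),
      Real.log_sqrt (div_pos hp hq).le]
    ring_nf
  have hsqrt : Real.sqrt (1 - m^2) = Real.sqrt (1 + m) * Real.sqrt (1 - m) := by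
    rw [← Real.sqrt_mul hp.le]
    ring_nf
  have hp' := Real.sqrt_pos.2 hp
  have hq' := Real.sqrt_pos.2 hq
  rw [Real.exp_neg, hexp, hsqrt]
  field_simp
  rw [Real.sq_sqrt hp.le, Real.sq_sqrt hq.le]
  ring

theorem stmt_10 :
    (∀ m : ℝ, m ∈ Set.Ioo (-1 : ℝ) 1 →
      Real.sqrt (1 - m^2) *
        (Real.exp (-(2 * ((1/4) * Real.log ((1 + m) / (1 - m)))))
         - Real.exp (2 * ((1/4) * Real.log ((1 + m) / (1 - m))))) = -2 * m) ∧
    (∀ (m m' : ℝ → ℝ), (∀ t, m t ∈ Set.Ioo (-1 : ℝ) 1) →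
      (∀ t, HasDerivAt m (m' t) t) →
      ((∀ t, m' t = Real.sqrt (1 - (m t)^2) *
          (Real.exp (2 * (-((1/4) * Real.log ((1 + m t) / (1 - m t)))))
           - Real.exp (-(2 * (-((1/4) * Real.log ((1 + m t) / (1 - m t))))))))
        ↔ (∀ t, m' t = -2 * m t))) := by
  refine ⟨fun m hm => sqrt_mul_exp_sub_exp_quarter_log hm, fun m m' hm _ => ?_⟩
  refine forall_congr' fun t => ?_
  rw [mul_neg, neg_neg, sqrt_mul_exp_sub_exp_quarter_log (hm t)]
end

section
/- Let n ≥ 1, let d ≥ 1, and let x₁,…,xₙ and y₁,…,yₙ be points of ℝᵈ. Let μ := (1/n)·Σᵢ δ_{xᵢ} and ν := (1/n)·Σⱼ δ_{yⱼ} be the corresponding empirical probability measures. Then the value (1/n)·min_{σ ∈ Sₙ} Σᵢ |xᵢ − y_{σ(i)}|² (minimum over all permutations σ of {1,…,n}) is the least element of the set of transport costs {∫_{ℝᵈ×ℝᵈ} |a − b|² dq(a,b) : q a measure on ℝᵈ×ℝᵈ whose first marginal is μ and whose second marginal is ν}. In other words, the squared Wasserstein distance between the two empirical measures equals (1/n)·inf_{σ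 ∈ Sₙ} Σᵢ |xᵢ − y_{σ(i)}|², and the infimum over couplings is attained. -/
open MeasureTheory ENNReal

/-- The partition of unity on the range of a finite family `x`, indexed by the family: the `i`-th
weight lives on `{x i}` and splits the unit mass equally among the repetitions of `x i`. -/
noncomputable def fiberWeight {ι α : Type*} (x : ι → α) (i : ι) : α → ℝ≥0∞ :=
  Set.indicator {x i} fun _ => ((Nat.card {k // x k = x i} : ℕ) : ℝ≥0∞)⁻¹

theorem measurable_fiberWeight {ι α : Type*} [MeasurableSpace α] [MeasurableSingletonClass α]
    (x : ι → α) (i : ι) : Measurable (fiberWeight x i) :=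
  measurable_const.indicator (measurableSet_singleton _)

theorem fiberWeight_comm {ι α : Type*} (x : ι → α) (i k : ι) :
    fiberWeight x i (x k) = fiberWeight x k (x i) := by
  by_cases h : x i = x k
  · simp [fiberWeight, h]
  · simp [fiberWeight, h, Ne.symm h]

theorem sum_fiberWeight_index {ι α : Type*} [Fintype ι] (x : ι → α) (i : ι) :
    ∑ k, fiberWeight x i (x k) = 1 := by
  classical
  have hne : ((Nat.card {k // x k = x i} : ℕ) : ℝ≥0∞) ≠ 0 := by
    have : Nonempty {k // x k = x i} := ⟨⟨i, rfl⟩⟩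
    exact_mod_cast Nat.card_pos.ne'
  simp only [fiberWeight, Set.indicator_apply, Set.mem_singleton_iff, ← Finset.sum_filter,
    Finset.sum_const, nsmul_eq_mul]
  rw [← Fintype.card_subtype, ← Nat.card_eq_fintype_card]
  exact ENNReal.mul_inv_cancel hne (natCast_ne_top _)

theorem sum_fiberWeight {ι α : Type*} [Fintype ι] (x : ι → α) (k : ι) :
    ∑ i, fiberWeight x i (x k) = 1 := by
  simp_rw [fun i => fiberWeight_comm x i k, sum_fiberWeight_index]

section Coupling

variable {n : ℕ} {α β : Type*} [MeasurableSpace α] [MeasurableSpace β]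

theorem ae_exists_eq_of_map_eq {γ : Type*} [MeasurableSpace γ] [MeasurableSingletonClass α]
    {q : Measure γ} {f : γ → α} (hf : Measurable f) {x : Fin n → α} {c : ℝ≥0∞}
    (h : q.map f = c • ∑ i, Measure.dirac (x i)) : ∀ᵐ p ∂q, ∃ k, f p = x k := by
  refine ae_of_ae_map (p := fun a => ∃ k, a = x k) hf.aemeasurable ?_
  rw [h]
  refine Measure.ae_smul_measure ?_ c
  rw [← Measure.sum_fintype]
  exact Measure.ae_sum_iff.2 fun i => by simp

theorem lintegral_of_map_eq {γ : Type*} [MeasurableSpace γ]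
    {q : Measure γ} {f : γ → α} (hf : Measurable f) {x : Fin n → α} {c : ℝ≥0∞}
    (h : q.map f = c • ∑ i, Measure.dirac (x i)) {g : α → ℝ≥0∞} (hg : Measurable g) :
    ∫⁻ p, g (f p) ∂q = c * ∑ i, g (x i) := by
  rw [← lintegral_map hg hf, h, lintegral_smul_measure, lintegral_finsetSum_measure]
  simp [lintegral_dirac' _ hg]

/-- The matrix with entries the (rescaled) masses that `q` gives to the pairs `(x i, y j)`. -/
noncomputable def couplingMatrix (x : Fin n → α) (y : Fin n → β) (q : Measure (α × β)) :
    Matrix (Fin n) (Fin n) ℝ≥0∞ :=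
  fun i j => n * ∫⁻ p, fiberWeight x i p.1 * fiberWeight y j p.2 ∂q

variable [MeasurableSingletonClass α] [MeasurableSingletonClass β]
  {x : Fin n → α} {y : Fin n → β} {q : Measure (α × β)}

theorem sum_couplingMatrix_row (hn : n ≠ 0)
    (hx : q.map Prod.fst = (n : ℝ≥0∞)⁻¹ • ∑ i, Measure.dirac (x i))
    (hy : q.map Prod.snd = (n : ℝ≥0∞)⁻¹ • ∑ j, Measure.dirac (y j)) (i : Fin n) :
    ∑ j, couplingMatrix x y q i j = 1 := by
  have hmx := measurable_fiberWeight x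
  have hmy := measurable_fiberWeight y
  simp only [couplingMatrix]
  rw [← Finset.mul_sum, ← lintegral_finsetSum _ fun j _ => by fun_prop]
  have : ∫⁻ p, ∑ j, fiberWeight x i p.1 * fiberWeight y j p.2 ∂q
      = ∫⁻ p, fiberWeight x i p.1 ∂q := by
    refine lintegral_congr_ae ?_
    filter_upwards [ae_exists_eq_of_map_eq measurable_snd hy] with p ⟨k, hk⟩
    rw [← Finset.mul_sum, hk, sum_fiberWeight, mul_one]
  rw [this, lintegral_of_map_eq measurable_fst hx (hmx i), sum_fiberWeight_index, mul_one]
  exact ENNReal.mul_inv_cancel (by exact_mod_cast hn) (natCast_ne_top _)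

theorem sum_couplingMatrix_col (hn : n ≠ 0)
    (hx : q.map Prod.fst = (n : ℝ≥0∞)⁻¹ • ∑ i, Measure.dirac (x i))
    (hy : q.map Prod.snd = (n : ℝ≥0∞)⁻¹ • ∑ j, Measure.dirac (y j)) (j : Fin n) :
    ∑ i, couplingMatrix x y q i j = 1 := by
  have hmx := measurable_fiberWeight x
  have hmy := measurable_fiberWeight y
  simp only [couplingMatrix]
  rw [← Finset.mul_sum, ← lintegral_finsetSum _ fun j _ => by fun_prop]
  have : ∫⁻ p, ∑ i, fiberWeight x i p.1 * fiberWeight y j p.2 ∂q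
      = ∫⁻ p, fiberWeight y j p.2 ∂q := by
    refine lintegral_congr_ae ?_
    filter_upwards [ae_exists_eq_of_map_eq measurable_fst hx] with p ⟨k, hk⟩
    rw [← Finset.sum_mul, hk, sum_fiberWeight, one_mul]
  rw [this, lintegral_of_map_eq measurable_snd hy (hmy j), sum_fiberWeight_index, mul_one]
  exact ENNReal.mul_inv_cancel (by exact_mod_cast hn) (natCast_ne_top _)

theorem sum_couplingMatrix_mul
    (hx : q.map Prod.fst = (n : ℝ≥0∞)⁻¹ • ∑ i, Measure.dirac (x i))
    (hy : q.map Prod.snd = (n : ℝ≥0∞)⁻¹ • ∑ j, Measure.dirac (y j)) (c : α × β → ℝ≥0∞) :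
    ∑ i, ∑ j, couplingMatrix x y q i j * c (x i, y j) = n * ∫⁻ p, c p ∂q := by
  have hmx := measurable_fiberWeight x
  have hmy := measurable_fiberWeight y
  have hc : ∫⁻ p, c p ∂q
      = ∫⁻ p, ∑ i, ∑ j, fiberWeight x i p.1 * fiberWeight y j p.2 * c (x i, y j) ∂q := by
    refine lintegral_congr_ae ?_
    filter_upwards [ae_exists_eq_of_map_eq measurable_fst hx,
      ae_exists_eq_of_map_eq measurable_snd hy] with p ⟨k, hk⟩ ⟨l, hl⟩
    have key : ∀ i j, fiberWeight x i p.1 * fiberWeight y j p.2 * c (x i, y j)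
        = fiberWeight x i p.1 * (fiberWeight y j p.2 * c p) := by
      intro i j
      by_cases h1 : p.1 = x i
      · by_cases h2 : p.2 = y j
        · rw [← h1, ← h2, mul_assoc]
        · simp [fiberWeight, h2]
      · simp [fiberWeight, h1]
    simp_rw [key, ← Finset.mul_sum, ← Finset.sum_mul, hk, hl, sum_fiberWeight, one_mul]
  rw [hc, lintegral_finsetSum _ fun i _ => by fun_prop, Finset.mul_sum]
  refine Finset.sum_congr rfl fun i _ => ?_
  rw [lintegral_finsetSum _ fun j _ => by fun_prop, Finset.mul_sum]
  refine Finset.sum_congr rfl fun j _ => ?_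
  rw [lintegral_mul_const _ (by fun_prop), couplingMatrix, mul_assoc]

end Coupling

/-- A linear functional on doubly stochastic matrices is bounded below by its minimum over
permutation matrices. -/
theorem iInf_perm_le_of_mem_doublyStochastic {ι : Type*} [Fintype ι] [DecidableEq ι]
    {M : Matrix ι ι ℝ} (hM : M ∈ doublyStochastic ℝ ι) (C : ι → ι → ℝ) :
    ⨅ σ : Equiv.Perm ι, ∑ i, C i (σ i) ≤ ∑ i, ∑ j, M i j * C i j := by
  obtain ⟨w, hw0, hw1, rfl⟩ := exists_eq_sum_perm_of_mem_doublyStochastic hM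
  have h : ∑ i, ∑ j, (∑ σ, w σ • σ.permMatrix ℝ) i j * C i j
      = ∑ σ : Equiv.Perm ι, w σ * ∑ i, C i (σ i) := by
    simp only [Matrix.sum_apply, Matrix.smul_apply, Finset.sum_mul, Finset.mul_sum]
    rw [Finset.sum_congr rfl fun i _ => Finset.sum_comm, Finset.sum_comm]
    refine Finset.sum_congr rfl fun σ _ => Finset.sum_congr rfl fun i _ => ?_
    simp [Equiv.Perm.permMatrix, PEquiv.toMatrix_apply]
  rw [h]
  calc ⨅ σ : Equiv.Perm ι, ∑ i, C i (σ i)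
      = ∑ τ, w τ * ⨅ σ : Equiv.Perm ι, ∑ i, C i (σ i) := by
        rw [← Finset.sum_mul, hw1, one_mul]
    _ ≤ _ := Finset.sum_le_sum fun τ _ =>
        mul_le_mul_of_nonneg_left (ciInf_le (Set.finite_range _).bddBelow τ) (hw0 τ)

theorem stmt_11
    (n d : ℕ) (hn : 1 ≤ n) (hd : 1 ≤ d)
    (x y : Fin n → EuclideanSpace ℝ (Fin d)) :
    IsLeast
      {c : ℝ≥0∞ |
        ∃ q : Measure (EuclideanSpace ℝ (Fin d) × EuclideanSpace ℝ (Fin d)),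
          q.map Prod.fst = (n : ℝ≥0∞)⁻¹ • ∑ i, Measure.dirac (x i) ∧
          q.map Prod.snd = (n : ℝ≥0∞)⁻¹ • ∑ j, Measure.dirac (y j) ∧
          c = ∫⁻ p, ENNReal.ofReal (‖p.1 - p.2‖^2) ∂q}
      (ENNReal.ofReal
        ((1 / n) * ⨅ σ : Equiv.Perm (Fin n), ∑ i, ‖x i - y (σ i)‖^2)) := by
  have hn0 : n ≠ 0 := by omega
  have hnpos : (0 : ℝ) < n := by exact_mod_cast hn
  have hofReal : ∀ r : ℝ, ENNReal.ofReal (1 / n * r) = (n : ℝ≥0∞)⁻¹ * ENNReal.ofReal r := by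
    intro r
    rw [ENNReal.ofReal_mul (by positivity), one_div, ENNReal.ofReal_inv_of_pos hnpos,
      ENNReal.ofReal_natCast]
  rw [hofReal]
  constructor
  · obtain ⟨σ, hσ⟩ := exists_eq_ciInf_of_finite
      (f := fun σ : Equiv.Perm (Fin n) => ∑ i, ‖x i - y (σ i)‖ ^ 2)
    refine ⟨(n : ℝ≥0∞)⁻¹ • ∑ i, Measure.dirac (x i, y (σ i)), ?_, ?_, ?_⟩
    · rw [Measure.map_smul, ← Measure.sum_fintype, Measure.map_sum measurable_fst.aemeasurable,
        Measure.sum_fintype]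
      simp [Measure.map_dirac' measurable_fst]
    · rw [Measure.map_smul, ← Measure.sum_fintype, Measure.map_sum measurable_snd.aemeasurable,
        Measure.sum_fintype]
      simp only [Measure.map_dirac' measurable_snd]
      rw [Equiv.sum_comp σ fun j => Measure.dirac (y j)]
    · rw [← hσ, lintegral_smul_measure, lintegral_finsetSum_measure,
        ENNReal.ofReal_sum_of_nonneg fun i _ => by positivity]
      simp
  · rintro c ⟨q, hx, hy, rfl⟩
    set A := couplingMatrix x y q with hA
    have hrow := sum_couplingMatrix_row hn0 hx hy
    have hcol := sum_couplingMatrix_col hn0 hx hy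
    have hfin : ∀ i j, A i j ≠ ∞ := fun i j =>
      ne_top_of_le_ne_top one_ne_top
        (hrow i ▸ Finset.single_le_sum (f := fun j => A i j) (fun _ _ => zero_le)
          (Finset.mem_univ j))
    have hM : (fun i j => (A i j).toReal : Matrix (Fin n) (Fin n) ℝ)
        ∈ doublyStochastic ℝ (Fin n) := by
      refine mem_doublyStochastic_iff_sum.2 ⟨fun i j => toReal_nonneg, fun i => ?_, fun j => ?_⟩
      · rw [← ENNReal.toReal_sum fun j _ => hfin i j, hrow, toReal_one]
      · rw [← ENNReal.toReal_sum fun i _ => hfin i j, hcol, toReal_one]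
    have hle := iInf_perm_le_of_mem_doublyStochastic hM fun i j => ‖x i - y j‖ ^ 2
    have hcost : ENNReal.ofReal (∑ i, ∑ j, (A i j).toReal * ‖x i - y j‖ ^ 2)
        = n * ∫⁻ p, ENNReal.ofReal (‖p.1 - p.2‖ ^ 2) ∂q := by
      rw [← sum_couplingMatrix_mul hx hy fun p => ENNReal.ofReal (‖p.1 - p.2‖ ^ 2),
        ENNReal.ofReal_sum_of_nonneg fun i _ => by positivity]
      refine Finset.sum_congr rfl fun i _ => ?_
      rw [ENNReal.ofReal_sum_of_nonneg fun j _ => by positivity]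
      refine Finset.sum_congr rfl fun j _ => ?_
      rw [ENNReal.ofReal_mul toReal_nonneg, ENNReal.ofReal_toReal (hfin i j)]
    calc (n : ℝ≥0∞)⁻¹ * ENNReal.ofReal (⨅ σ : Equiv.Perm (Fin n), ∑ i, ‖x i - y (σ i)‖ ^ 2)
        ≤ (n : ℝ≥0∞)⁻¹ * (n * ∫⁻ p, ENNReal.ofReal (‖p.1 - p.2‖ ^ 2) ∂q) := by
          rw [← hcost]
          gcongr
      _ = ∫⁻ p, ENNReal.ofReal (‖p.1 - p.2‖ ^ 2) ∂q := by
          rw [← mul_assoc, ENNReal.inv_mul_cancel (by exact_mod_cast hn0) (natCast_ne_top _),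
            one_mul]
end
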